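/- Let P be a simple polygon and W a witness set of P; assume Vis(u) equals the closure of its interior for every u ∈ W. Then the neighbor witness graph GCon(W) is chordal: for every cycle w₁, …, w_m in GCon(W) with m ≥ 4 (distinct vertices with w_i adjacent to w_{i+1 mod m} for all i), there exist two vertices of the cycle that are not consecutive on the cycle but are adjacent in GCon(W) (a chord). -/

import Mathlib

open Set

noncomputable section

abbrev Plane := EuclideanSpace ℝ (Fin 2)

/-- A simple polygon, given by a cyclic sequence of at least three distinct vertices
whose closed polygonal boundary curve is a Jordan polygon: two edges intersect exactly
when they are consecutive, and then only in their one shared endpoint. -/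
structure SimplePolygon where
  n : ℕ
  three_le : 3 ≤ n
  vertex : ℕ → Plane
  periodic : ∀ i, vertex (i + n) = vertex i
  inj : ∀ i < n, ∀ j < n, vertex i = vertex j → i = j
  jordan : ∀ i < n, ∀ j < n, i ≠ j →
    segment ℝ (vertex i) (vertex (i + 1)) ∩ segment ℝ (vertex j) (vertex (j + 1)) =
      if j = (i + 1) % n then {vertex (i + 1)}
      else if i = (j + 1) % n then {vertex (j + 1)}
      else ∅

namespace SimplePolygon

/-- The boundary curve of the polygon: the union of its edges. -/
def boundary (P : SimplePolygon) : Set Plane :=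
  ⋃ i ∈ Finset.range P.n, segment ℝ (P.vertex i) (P.vertex (i + 1))

/-- The polygon as a region: the boundary together with all bounded connected
components of the complement of the boundary. -/
def region (P : SimplePolygon) : Set Plane :=
  P.boundary ∪ {x | x ∉ P.boundary ∧
    Bornology.IsBounded (connectedComponentIn P.boundaryᶜ x)}

/-- Visibility region of a point `p`: all points `q` of the polygon such that the
closed segment `[p,q]` is contained in the polygon. -/
def Vis (P : SimplePolygon) (p : Plane) : Set Plane :=
  {q | q ∈ P.region ∧ segment ℝ p q ⊆ P.region}

/-- Visibility region of a set. -/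
def VisSet (P : SimplePolygon) (S : Set Plane) : Set Plane :=
  ⋃ p ∈ S, P.Vis p

/-- Two points of the polygon are visible to each other if the segment joining them
lies in the polygon. -/
def Visible (P : SimplePolygon) (p q : Plane) : Prop :=
  p ∈ P.region ∧ q ∈ P.region ∧ segment ℝ p q ⊆ P.region

/-- A witness set: a finite set of points of the polygon with pairwise disjoint
visibility regions. -/
def IsWitnessSet (P : SimplePolygon) (W : Set Plane) : Prop :=
  W.Finite ∧ W ⊆ P.region ∧
    ∀ x ∈ W, ∀ y ∈ W, x ≠ y → P.Vis x ∩ P.Vis y = ∅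

/-- The non-visible region of a witness set. -/
def NVis (P : SimplePolygon) (W : Set Plane) : Set Plane :=
  P.region \ ⋃ w ∈ W, P.Vis w

/-- `Vis p` is regular (has no arms) if it equals the closure of its interior. -/
def VisRegular (P : SimplePolygon) (p : Plane) : Prop :=
  P.Vis p = closure (interior (P.Vis p))

/-- A window of `Vis p`: a non-degenerate closed segment contained in the frontier of
`Vis p` whose intersection with the frontier of the polygon is exactly its two
endpoints, maximal with these properties. -/
def IsWindow (P : SimplePolygon) (p : Plane) (e : Set Plane) : Prop :=
  ∃ a b : Plane, a ≠ b ∧ e = segment ℝ a b ∧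
    e ⊆ frontier (P.Vis p) ∧
    e ∩ frontier P.region = {a, b} ∧
    ∀ a' b' : Plane, a' ≠ b' →
      segment ℝ a' b' ⊆ frontier (P.Vis p) →
      segment ℝ a' b' ∩ frontier P.region = {a', b'} →
      e ⊆ segment ℝ a' b' → e = segment ℝ a' b'

/-- `γ` is (the image of) a neighbor witness path between `w` and `w'`. -/
def IsNWPath (P : SimplePolygon) (W : Set Plane) (w w' : Plane) (γ : Set Plane) : Prop :=
  ∃ f : Path w w', γ = Set.range f ∧ γ ⊆ P.Vis w ∪ P.NVis W ∪ P.Vis w'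

/-- Adjacency in the neighbor witness graph `GCon(W)`. -/
def GConAdj (P : SimplePolygon) (W : Set Plane) (w w' : Plane) : Prop :=
  w ∈ W ∧ w' ∈ W ∧ w ≠ w' ∧ ∃ γ : Set Plane, P.IsNWPath W w w' γ

/-- A connected component `NV` of `NVis W` is attached to `Vis w` if the closure of
`NV` intersects `Vis w`. -/
def Attached (P : SimplePolygon) (NV : Set Plane) (w : Plane) : Prop :=
  (closure NV ∩ P.Vis w).Nonempty

/-- `w` is a simplicial vertex of `GCon(W)`: its neighbors are pairwise adjacent. -/
def Simplicial (P : SimplePolygon) (W : Set Plane) (w : Plane) : Prop :=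
  ∀ u v : Plane, P.GConAdj W w u → P.GConAdj W w v → u ≠ v → P.GConAdj W u v

end SimplePolygon

/-- `NV` is a connected component of `S`. -/
def IsCompOf (NV S : Set Plane) : Prop :=
  ∃ x ∈ S, NV = connectedComponentIn S x

/-- `f` has a continuous logarithm on `S`. -/
def HasLog {X : Type*} [TopologicalSpace X] (f : X → ℂ) (S : Set X) : Prop :=
  ∃ h : X → ℂ, ContinuousOn h S ∧ ∀ x ∈ S, Complex.exp (h x) = f x

namespace HasLog

variable {X : Type*} [TopologicalSpace X] {f g : X → ℂ} {S T : Set X}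

theorem mono (hf : HasLog f S) (h : T ⊆ S) : HasLog f T :=
  let ⟨k, hk, e⟩ := hf
  ⟨k, hk.mono h, fun x hx => e x (h hx)⟩

theorem congr (hf : HasLog f S) (h : ∀ x ∈ S, f x = g x) : HasLog g S :=
  let ⟨k, hk, e⟩ := hf
  ⟨k, hk, fun x hx => (e x hx).trans (h x hx)⟩

theorem mul (hf : HasLog f S) (hg : HasLog g S) : HasLog (fun x => f x * g x) S := by
  obtain ⟨k, hk, e⟩ := hf
  obtain ⟨l, hl, e'⟩ := hg
  exact ⟨fun x => k x + l x, hk.add hl, fun x hx => by rw [Complex.exp_add, e x hx, e' x hx]⟩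

theorem zpow (hf : HasLog f S) (n : ℤ) : HasLog (fun x => f x ^ n) S := by
  obtain ⟨k, hk, e⟩ := hf
  exact ⟨fun x => n * k x, continuousOn_const.mul hk, fun x hx => by
    rw [Complex.exp_int_mul, e x hx]⟩

theorem inv (hf : HasLog f S) : HasLog (fun x => (f x)⁻¹) S := by
  simpa using hf.zpow (-1)

theorem const {c : ℂ} (hc : c ≠ 0) : HasLog (fun _ : X => c) S :=
  ⟨fun _ => Complex.log c, continuousOn_const, fun _ _ => Complex.exp_log hc⟩

theorem of_mem_slitPlane (hf : ContinuousOn f S) (h : ∀ x ∈ S, f x ∈ Complex.slitPlane) :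
    HasLog f S :=
  ⟨fun x => Complex.log (f x), fun x hx => (hf x hx).clog (h x hx),
    fun x hx => Complex.exp_log (Complex.slitPlane_ne_zero (h x hx))⟩

theorem of_agree (hS : IsClosed S) (hT : IsClosed T) {k l : X → ℂ} (hk : ContinuousOn k S)
    (hl : ContinuousOn l T) (ek : ∀ x ∈ S, Complex.exp (k x) = f x)
    (el : ∀ x ∈ T, Complex.exp (l x) = f x) (h : ∀ x ∈ S ∩ T, k x = l x) :
    HasLog f (S ∪ T) := by
  classical
  have hST : EqOn (S.piecewise k l) l T := fun x hx => by
    by_cases hxS : x ∈ S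
    · rw [piecewise_eq_of_mem _ _ _ hxS, h x ⟨hxS, hx⟩]
    · rw [piecewise_eq_of_notMem _ _ _ hxS]
  refine ⟨S.piecewise k l, ContinuousOn.union_of_isClosed
    (hk.congr (piecewise_eqOn S k l)) (hl.congr hST) hS hT, ?_⟩
  rintro x (hx | hx)
  · rw [piecewise_eq_of_mem _ _ _ hx, ek x hx]
  · rw [hST hx, el x hx]

theorem union_of_inter_eq_singleton (hS : IsClosed S) (hT : IsClosed T) {p : X}
    (hp : S ∩ T = {p}) (hfS : HasLog f S) (hfT : HasLog f T) : HasLog f (S ∪ T) := by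
  obtain ⟨k, hk, ek⟩ := hfS
  obtain ⟨l, hl, el⟩ := hfT
  have hpST : p ∈ S ∩ T := hp ▸ mem_singleton p
  refine of_agree hS hT (l := fun x => l x + (k p - l p)) hk (hl.add continuousOn_const) ek ?_ ?_
  · intro x hx
    rw [Complex.exp_add, Complex.exp_sub, el x hx, ek p hpST.1, el p hpST.2, div_self, mul_one]
    rw [← el p hpST.2]
    exact Complex.exp_ne_zero _
  · intro x hx
    rw [hp] at hx
    rw [mem_singleton_iff.1 hx]
    ring

theorem exists_continuousMap [NormalSpace X] (hS : IsClosed S) (hf : HasLog f S) :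
    ∃ H : C(X, ℂ), ∀ x ∈ S, Complex.exp (H x) = f x := by
  obtain ⟨k, hk, ek⟩ := hf
  obtain ⟨H, hH⟩ := ContinuousMap.exists_restrict_eq hS ⟨S.domRestrict k, hk.domRestrict⟩
  refine ⟨H, fun x hx => ?_⟩
  have h : H x = k x := DFunLike.congr_fun hH ⟨x, hx⟩
  rw [h, ek x hx]

theorem of_continuous [SimplyConnectedSpace X] [LocallyPathConnectedSpace X] (hf : Continuous f)
    (h0 : ∀ x, f x ≠ 0) : HasLog f S := by
  obtain ⟨a⟩ : Nonempty X := inferInstance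
  obtain ⟨F, ⟨-, hF⟩, -⟩ := Complex.isCoveringMap_exp.existsUnique_continuousMap_lifts
    ⟨fun x => (⟨f x, h0 x⟩ : {z : ℂ // z ≠ 0}), hf.subtype_mk h0⟩ a (Complex.log (f a))
    (Subtype.ext (Complex.exp_log (h0 a)))
  exact ⟨F, F.continuous.continuousOn, fun x _ => congrArg Subtype.val (congrFun hF x)⟩

end HasLog

theorem exists_int_sub_eq_of_exp_eq {a b : ℂ} (h : Complex.exp a = Complex.exp b) :
    ∃ n : ℤ, a - b = n * (2 * Real.pi * Complex.I) := by
  obtain ⟨n, hn⟩ := Complex.exp_eq_exp_iff_exists_int.1 h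
  exact ⟨n, by rw [hn]; ring⟩

/-- Two continuous logarithms of a function on a preconnected set differ by a constant. -/
theorem log_sub_log_eq {X : Type*} [TopologicalSpace X] {S : Set X} (hS : IsPreconnected S)
    {k l : X → ℂ} (hk : ContinuousOn k S) (hl : ContinuousOn l S)
    (h : ∀ x ∈ S, Complex.exp (k x) = Complex.exp (l x)) {x y : X} (hx : x ∈ S) (hy : y ∈ S) :
    k x - l x = k y - l y := by
  have hd : ContinuousOn (fun z => ((k z - l z) / (2 * Real.pi * Complex.I)).re) S :=
    Complex.continuous_re.comp_continuousOn ((hk.sub hl).div_const _)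
  have hT : IsDiscrete (range ((↑) : ℤ → ℝ)) :=
    ⟨Int.isClosedEmbedding_coe_real.isEmbedding.toHomeomorph.symm.isEmbedding.discreteTopology⟩
  have key : ∀ z ∈ S, ∃ n : ℤ, k z - l z = n * (2 * Real.pi * Complex.I) := fun z hz =>
    exists_int_sub_eq_of_exp_eq (h z hz)
  have val : ∀ {z : X} {n : ℤ}, k z - l z = n * (2 * Real.pi * Complex.I) →
      ((k z - l z) / (2 * Real.pi * Complex.I)).re = n := fun hn => by
    rw [hn, mul_div_cancel_right₀ _ Complex.two_pi_I_ne_zero, Complex.intCast_re]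
  have hc := hS.constant_of_mapsTo hT hd
    (fun z hz => by obtain ⟨n, hn⟩ := key z hz; exact ⟨n, (val hn).symm⟩) hx hy
  obtain ⟨a, ha⟩ := key x hx
  obtain ⟨b, hb⟩ := key y hy
  rw [val ha, val hb, Int.cast_inj] at hc
  rw [ha, hb, hc]

/-- A function without zeros on a segment has a continuous logarithm there. -/
theorem hasLog_segment {f : Plane → ℂ} {a b : Plane} (hf : ContinuousOn f (segment ℝ a b))
    (h0 : ∀ x ∈ segment ℝ a b, f x ≠ 0) : HasLog f (segment ℝ a b) := by
  let τ : Plane → Icc (0 : ℝ) 1 := fun x =>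
    projIcc 0 1 zero_le_one (inner ℝ (x - a) (b - a) / ‖b - a‖ ^ 2)
  let ρ : Plane → Plane := fun x => AffineMap.lineMap a b (τ x : ℝ)
  have hτ : Continuous τ := continuous_projIcc.comp (by fun_prop)
  have hρ : Continuous ρ :=
    AffineMap.lineMap_continuous.comp (continuous_subtype_val.comp hτ)
  have hmem : ∀ x, ρ x ∈ segment ℝ a b := fun x => by
    rw [segment_eq_image_lineMap]
    exact ⟨τ x, (τ x).2, rfl⟩
  have hfix : ∀ x ∈ segment ℝ a b, ρ x = x := by
    intro x hx
    rw [segment_eq_image_lineMap] at hx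
    obtain ⟨t, ht, rfl⟩ := hx
    rcases eq_or_ne a b with rfl | hab
    · simp [ρ]
    · have hne : ‖b - a‖ ^ 2 ≠ 0 := pow_ne_zero 2 (norm_ne_zero_iff.2 (sub_ne_zero.2 hab.symm))
      have : inner ℝ (AffineMap.lineMap a b t - a) (b - a) / ‖b - a‖ ^ 2 = t := by
        rw [AffineMap.lineMap_apply_module', add_sub_cancel_right, real_inner_smul_left,
          real_inner_self_eq_norm_sq, mul_div_cancel_right₀ _ hne]
      simp only [ρ, τ, this, projIcc_of_mem zero_le_one ht]
  refine (HasLog.of_continuous (f := fun x => f (ρ x)) (hf.comp_continuous hρ hmem)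
    (fun x => h0 _ (hmem x))).congr fun x hx => by rw [hfix x hx]

theorem exp_two_arctan_mul_I (s : ℝ) :
    Complex.exp ((2 * Real.arctan s : ℝ) * Complex.I) =
      (1 + s * Complex.I) / (1 - s * Complex.I) := by
  have hc : (Real.cos (Real.arctan s) : ℂ) ≠ 0 :=
    Complex.ofReal_ne_zero.2 (Real.cos_arctan_pos s).ne'
  have hs : (Real.sin (Real.arctan s) : ℂ) = s * Real.cos (Real.arctan s) := by
    have h := Real.tan_arctan s
    rw [Real.tan_eq_sin_div_cos, div_eq_iff (Real.cos_arctan_pos s).ne'] at h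
    rw [h, Complex.ofReal_mul]
  have hne : 1 - (s : ℂ) * Complex.I ≠ 0 := fun h => by
    simpa using congrArg Complex.re h
  have e : ((2 * Real.arctan s : ℝ) : ℂ) * Complex.I =
      Real.arctan s * Complex.I - (-Real.arctan s : ℝ) * Complex.I := by push_cast; ring
  rw [e, Complex.exp_sub, Complex.exp_mul_I, Complex.exp_mul_I, ← Complex.ofReal_cos,
    ← Complex.ofReal_cos, ← Complex.ofReal_sin, ← Complex.ofReal_sin, Real.cos_neg, Real.sin_neg,
    Complex.ofReal_neg, hs, div_eq_div_iff _ hne]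
  · ring
  · intro h
    apply hne
    have : (Real.cos (Real.arctan s) : ℂ) * (1 - s * Complex.I) = 0 := by rw [← h]; ring
    exact (mul_eq_zero.1 this).resolve_left hc

/-- The identification of the plane with the complex numbers. -/
def toComplex : Plane ≃ₗᵢ[ℝ] ℂ := Complex.orthonormalBasisOneI.repr.symm

namespace SimplePolygon

variable (P : SimplePolygon)

theorem isCompact_boundary : IsCompact P.boundary :=
  (Finset.range P.n).isCompact_biUnion fun i _ => by
    rw [segment_eq_image_lineMap]
    exact isCompact_Icc.image AffineMap.lineMap_continuous

theorem isClosed_segment (a b : Plane) : IsClosed (segment ℝ a b) := by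
  rw [segment_eq_image_lineMap]
  exact (isCompact_Icc.image AffineMap.lineMap_continuous).isClosed

theorem isClosed_boundary : IsClosed P.boundary := P.isCompact_boundary.isClosed

theorem boundary_subset_region : P.boundary ⊆ P.region := subset_union_left

theorem isOpen_setOf_connectedComponentIn (p : Set Plane → Prop) :
    IsOpen {x | x ∉ P.boundary ∧ p (connectedComponentIn P.boundaryᶜ x)} := by
  have ho : IsOpen P.boundaryᶜ := P.isClosed_boundary.isOpen_compl
  refine isOpen_iff_mem_nhds.2 fun x ⟨hx, hb⟩ => ?_
  refine Filter.mem_of_superset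
    (ho.connectedComponentIn.mem_nhds (mem_connectedComponentIn (F := P.boundaryᶜ) hx))
    fun y hy => ⟨connectedComponentIn_subset _ _ hy, ?_⟩
  rwa [← connectedComponentIn_eq hy]

theorem isOpen_region_diff_boundary : IsOpen (P.region \ P.boundary) := by
  convert P.isOpen_setOf_connectedComponentIn Bornology.IsBounded using 1
  ext x
  simp only [region, mem_sdiff, mem_union, mem_ofPred_eq]
  tauto

theorem isClosed_region : IsClosed P.region := by
  rw [← isOpen_compl_iff]
  convert P.isOpen_setOf_connectedComponentIn (fun s => ¬ Bornology.IsBounded s) using 1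
  ext x
  simp only [region, mem_compl_iff, mem_union, mem_ofPred_eq]
  tauto

/-- The exterior together with the boundary. -/
def closedExterior : Set Plane := (P.region \ P.boundary)ᶜ

theorem boundary_subset_closedExterior : P.boundary ⊆ P.closedExterior :=
  fun _ hx h => h.2 hx

theorem isClosed_Vis (p : Plane) : IsClosed (P.Vis p) := by
  have : P.Vis p = P.region ∩
      ⋂ t ∈ Icc (0 : ℝ) 1, (fun q => AffineMap.lineMap p q t) ⁻¹' P.region := by
    ext q
    simp only [Vis, segment_eq_image_lineMap, image_subset_iff, mem_ofPred_eq, mem_inter_iff,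
      mem_iInter]
    exact Iff.rfl
  rw [this]
  refine P.isClosed_region.inter (isClosed_biInter fun t _ => P.isClosed_region.preimage ?_)
  simp only [AffineMap.lineMap_apply_module]
  fun_prop

theorem boundary_eq_union : P.boundary =
    (⋃ i ∈ Finset.Ico 1 P.n, segment ℝ (P.vertex i) (P.vertex (i + 1))) ∪
      segment ℝ (P.vertex 0) (P.vertex 1) := by
  have h3 := P.three_le
  ext x
  simp only [boundary, mem_iUnion, Finset.mem_range, Finset.mem_Ico, mem_union, exists_prop]
  constructor
  · rintro ⟨i, hi, hx⟩
    rcases Nat.eq_zero_or_pos i with rfl | h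
    · exact Or.inr hx
    · exact Or.inl ⟨i, ⟨h, hi⟩, hx⟩
  · rintro (⟨i, ⟨-, hi⟩, hx⟩ | hx)
    · exact ⟨i, hi, hx⟩
    · exact ⟨0, by omega, hx⟩

theorem vertex_n : P.vertex P.n = P.vertex 0 := by simpa using P.periodic 0

theorem vertex_zero_mem_boundary : P.vertex 0 ∈ P.boundary := by
  rw [boundary_eq_union]
  exact Or.inr (left_mem_segment ℝ _ _)

/-- The union of all edges but the first. -/
def arc : Set Plane := ⋃ i ∈ Finset.Ico 1 P.n, segment ℝ (P.vertex i) (P.vertex (i + 1))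

theorem isClosed_arc : IsClosed P.arc :=
  isClosed_biUnion_finset fun _ _ => isClosed_segment _ _

theorem vertex_zero_mem_arc : P.vertex 0 ∈ P.arc := by
  have h3 := P.three_le
  refine mem_biUnion (x := P.n - 1) (Finset.mem_coe.2 (Finset.mem_Ico.2 ⟨by omega, by omega⟩)) ?_
  rw [Nat.sub_add_cancel (by omega), P.vertex_n]
  exact right_mem_segment ℝ _ _

theorem vertex_one_mem_arc : P.vertex 1 ∈ P.arc := by
  have h3 := P.three_le
  exact mem_biUnion (x := 1) (Finset.mem_coe.2 (Finset.mem_Ico.2 ⟨by omega, by omega⟩))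
    (left_mem_segment ℝ _ _)

theorem arc_inter_segment_subset :
    P.arc ∩ segment ℝ (P.vertex 0) (P.vertex 1) ⊆ {P.vertex 0, P.vertex 1} := by
  have h3 := P.three_le
  rintro x ⟨hx, hx0⟩
  simp only [arc, mem_iUnion, Finset.mem_Ico, exists_prop] at hx
  obtain ⟨i, ⟨h1, hn⟩, hx⟩ := hx
  have hj := P.jordan 0 (by omega) i hn (by omega)
  have hmem : x ∈ segment ℝ (P.vertex 0) (P.vertex (0 + 1)) ∩
    segment ℝ (P.vertex i) (P.vertex (i + 1)) := ⟨hx0, hx⟩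
  rw [hj] at hmem
  split_ifs at hmem with ha hb
  · exact Or.inr hmem
  · left
    have : i + 1 = P.n := by
      by_contra hne
      rw [Nat.mod_eq_of_lt (by omega)] at hb
      omega
    rwa [this, P.vertex_n] at hmem
  · exact hmem.elim

theorem hasLog_arc {f : Plane → ℂ} (hf : ContinuousOn f P.boundary)
    (h0 : ∀ x ∈ P.boundary, f x ≠ 0) : HasLog f P.arc := by
  have h3 := P.three_le
  have hseg : ∀ i < P.n, HasLog f (segment ℝ (P.vertex i) (P.vertex (i + 1))) := fun i hi => by
    have hsub : segment ℝ (P.vertex i) (P.vertex (i + 1)) ⊆ P.boundary :=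
      subset_biUnion_of_mem (u := fun i => segment ℝ (P.vertex i) (P.vertex (i + 1)))
        (Finset.mem_coe.2 (Finset.mem_range.2 hi))
    exact hasLog_segment (hf.mono hsub) fun x hx => h0 x (hsub hx)
  have key : ∀ k, 2 ≤ k → k ≤ P.n →
      HasLog f (⋃ i ∈ Finset.Ico 1 k, segment ℝ (P.vertex i) (P.vertex (i + 1))) := by
    intro k hk
    induction k, hk using Nat.le_induction with
    | base => intro _; simpa using hseg 1 (by omega)
    | succ k hk ih =>
      intro hkn
      have hIco : Finset.Ico 1 (k + 1) = insert k (Finset.Ico 1 k) := by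
        ext j; simp only [Finset.mem_Ico, Finset.mem_insert]; omega
      rw [hIco, Finset.set_biUnion_insert, union_comm]
      refine HasLog.union_of_inter_eq_singleton (p := P.vertex k)
        (isClosed_biUnion_finset fun _ _ => isClosed_segment _ _) (isClosed_segment _ _) ?_
        (ih (by omega)) (hseg k (by omega))
      refine Subset.antisymm ?_ (singleton_subset_iff.2
        ⟨mem_biUnion (x := k - 1) (Finset.mem_coe.2 (Finset.mem_Ico.2 ⟨by omega, by omega⟩)) ?_,
          left_mem_segment ℝ _ _⟩)
      · rintro x ⟨hx, hxk⟩
        simp only [mem_iUnion, Finset.mem_Ico, exists_prop] at hx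
        obtain ⟨i, ⟨h1, hik⟩, hx⟩ := hx
        have hmem : x ∈ segment ℝ (P.vertex i) (P.vertex (i + 1)) ∩
          segment ℝ (P.vertex k) (P.vertex (k + 1)) := ⟨hx, hxk⟩
        rw [P.jordan i (by omega) k (by omega) (by omega), Nat.mod_eq_of_lt (by omega)] at hmem
        split_ifs at hmem with ha hb
        · rwa [ha]
        · rcases Nat.lt_or_ge (k + 1) P.n with h | h
          · rw [Nat.mod_eq_of_lt h] at hb; omega
          · rw [show k + 1 = P.n by omega, Nat.mod_self] at hb; omega
        · exact hmem.elim
      · rw [Nat.sub_add_cancel (by omega)]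
        exact right_mem_segment ℝ _ _
  exact key P.n (by omega) le_rfl

/-- Two logarithms, on the arc and on the first edge, whose jumps at the common endpoints agree
glue to a logarithm on the boundary. -/
theorem hasLog_boundary_of_jump {f k l : Plane → ℂ} (hk : ContinuousOn k P.arc)
    (hl : ContinuousOn l (segment ℝ (P.vertex 0) (P.vertex 1)))
    (ek : ∀ x ∈ P.arc, Complex.exp (k x) = f x)
    (el : ∀ x ∈ segment ℝ (P.vertex 0) (P.vertex 1), Complex.exp (l x) = f x)
    (hjump : k (P.vertex 1) - l (P.vertex 1) = k (P.vertex 0) - l (P.vertex 0)) :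
    HasLog f P.boundary := by
  rw [boundary_eq_union]
  refine HasLog.of_agree P.isClosed_arc (isClosed_segment _ _) hk
    (l := fun x => l x + (k (P.vertex 0) - l (P.vertex 0))) (hl.add continuousOn_const) ek ?_ ?_
  · intro x hx
    have h0 := left_mem_segment ℝ (P.vertex 0) (P.vertex 1)
    rw [Complex.exp_add, Complex.exp_sub, ek _ P.vertex_zero_mem_arc, ← el _ h0,
      div_self (Complex.exp_ne_zero _), mul_one, el x hx]
  · intro x hx
    rcases P.arc_inter_segment_subset hx with rfl | rfl
    · ring
    · rw [← hjump]; ring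

end SimplePolygon

namespace SimplePolygon

variable (P : SimplePolygon)

/-- There are two points off the boundary, a zero and a pole, whose quotient function generates all
nowhere vanishing functions on the boundary up to exponentials. -/
theorem exists_generator : ∃ q q' : Plane, q ∉ P.boundary ∧ q' ∉ P.boundary ∧
    ∀ f : Plane → ℂ, ContinuousOn f P.boundary → (∀ x ∈ P.boundary, f x ≠ 0) →
      ∃ n : ℤ, HasLog (fun x => f x *
        ((toComplex x - toComplex q) / (toComplex x - toComplex q')) ^ n) P.boundary := by
  have h3 := P.three_le
  set v0 := P.vertex 0 with hv0
  set v1 := P.vertex 1 with hv1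
  have hne : v0 ≠ v1 := fun h => by
    simpa using P.inj 0 (by omega) 1 (by omega) h
  set J := segment ℝ v0 v1 with hJ
  set M : Plane := AffineMap.lineMap v0 v1 (1 / 2 : ℝ) with hM
  have hMJ : M ∈ J := by
    rw [hJ, segment_eq_image_lineMap]
    exact ⟨1 / 2, by norm_num, rfl⟩
  set u : ℂ := toComplex v1 - toComplex v0 with hu
  have hu0 : u ≠ 0 := sub_ne_zero.2 fun h => hne (toComplex.injective h).symm
  have hline : ∀ t : ℝ, toComplex (AffineMap.lineMap v0 v1 t) = toComplex v0 + t * u := fun t => by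
    rw [AffineMap.lineMap_apply_module', map_add, map_smul, map_sub, Complex.real_smul, add_comm]
  have hMc : toComplex M = toComplex v0 + 1 / 2 * u := by
    rw [hM, hline]; push_cast; rfl
  have hMarc : M ∉ P.arc := fun h => by
    rcases P.arc_inter_segment_subset ⟨h, hMJ⟩ with h | h
    · have h' := congrArg toComplex h
      rw [hMc, ← hv0, add_eq_left] at h'
      simp [hu0] at h'
    · have h' := congrArg toComplex (mem_singleton_iff.1 h)
      rw [hMc, ← hv1, show toComplex v1 = toComplex v0 + u by rw [hu]; ring, add_right_inj] at h'
      have : (1 / 2 : ℂ) * u = 1 * u := by rw [h', one_mul]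
      have := mul_right_cancel₀ hu0 this
      norm_num at this
  obtain ⟨δ, hδ, hball⟩ : ∃ δ > 0, ∀ x ∈ P.arc, δ ≤ ‖toComplex x - toComplex M‖ := by
    obtain ⟨δ, hδ, h⟩ := Metric.isOpen_iff.1 P.isClosed_arc.isOpen_compl M hMarc
    refine ⟨δ, hδ, fun x hx => ?_⟩
    by_contra! hlt
    refine h (show x ∈ Metric.ball M δ from ?_) hx
    rwa [Metric.mem_ball, ← toComplex.dist_map, dist_eq_norm]
  set ε : ℝ := δ / (4 * ‖u‖) with hε
  have hunorm : 0 < ‖u‖ := norm_pos_iff.2 hu0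
  have hε0 : 0 < ε := by positivity
  have hεu : ‖(ε : ℂ) * Complex.I * u‖ = δ / 4 := by
    rw [norm_mul, norm_mul, Complex.norm_I, Complex.norm_real, Real.norm_of_nonneg hε0.le, hε]
    field_simp
  set q : Plane := toComplex.symm (toComplex M + ε * Complex.I * u) with hq
  set q' : Plane := toComplex.symm (toComplex M - ε * Complex.I * u) with hq'
  have hqc : toComplex q = toComplex M + ε * Complex.I * u := by simp [hq]
  have hqc' : toComplex q' = toComplex M - ε * Complex.I * u := by simp [hq']
  have hJpt : ∀ x ∈ J, ∃ t : ℝ, toComplex x = toComplex M + t * u := fun x hx => by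
    rw [hJ, segment_eq_image_lineMap] at hx
    obtain ⟨t, -, rfl⟩ := hx
    refine ⟨t - 1 / 2, ?_⟩
    rw [hline, hMc]; push_cast; ring
  have hare : ∀ t : ℝ, (t : ℂ) - ε * Complex.I ≠ 0 := fun t h => by
    have := congrArg Complex.im h
    simp [hε0.ne'] at this
  have hare' : ∀ t : ℝ, (t : ℂ) + ε * Complex.I ≠ 0 := fun t h => by
    have := congrArg Complex.im h
    simp [hε0.ne'] at this
  have hb : ∀ x ∈ P.boundary, toComplex x - toComplex q ≠ 0 ∧ toComplex x - toComplex q' ≠ 0 := by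
    intro x hx
    rw [boundary_eq_union] at hx
    rcases hx with hx | hx
    · have := hball x hx
      constructor
      · intro h
        rw [hqc] at h
        rw [show toComplex x - toComplex M = ε * Complex.I * u by linear_combination h, hεu] at this
        linarith
      · intro h
        rw [hqc'] at h
        rw [show toComplex x - toComplex M = -(ε * Complex.I * u) by linear_combination h,
          norm_neg, hεu] at this
        linarith
    · obtain ⟨t, ht⟩ := hJpt x hx
      rw [ht, hqc, hqc']
      constructor
      · rw [show toComplex M + t * u - (toComplex M + ε * Complex.I * u) =
          (t - ε * Complex.I) * u by ring]
        exact mul_ne_zero (hare t) hu0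
      · rw [show toComplex M + t * u - (toComplex M - ε * Complex.I * u) =
          (t + ε * Complex.I) * u by ring]
        exact mul_ne_zero (hare' t) hu0
  set r : Plane → ℂ := fun x => (toComplex x - toComplex q) / (toComplex x - toComplex q') with hr
  have hrc : ContinuousOn r P.boundary := by
    refine ContinuousOn.div ?_ ?_ fun x hx => (hb x hx).2
    · exact (toComplex.continuous.sub continuous_const).continuousOn
    · exact (toComplex.continuous.sub continuous_const).continuousOn
  have harc : P.arc ⊆ P.boundary := by rw [boundary_eq_union]; exact subset_union_left
  have hJb : J ⊆ P.boundary := by rw [boundary_eq_union]; exact subset_union_right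
  have hslit : ∀ x ∈ P.arc, r x ∈ Complex.slitPlane := by
    intro x hx
    have h2 := (hb x (harc hx)).2
    have hrx : r x = 1 + -(2 * (ε * Complex.I * u)) / (toComplex x - toComplex q') := by
      rw [hr]
      simp only
      rw [div_eq_iff h2, add_mul, div_mul_cancel₀ _ h2, hqc, hqc']
      ring
    rw [hrx]
    refine Complex.mem_slitPlane_of_norm_lt_one ?_
    rw [norm_div, div_lt_one (norm_pos_iff.2 h2), norm_neg, norm_mul, hεu, hqc']
    have h4 := hball x hx
    have h5 : ‖toComplex x - toComplex M‖ ≤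
        ‖toComplex x - (toComplex M - ε * Complex.I * u)‖ + ‖(ε : ℂ) * Complex.I * u‖ := by
      have := norm_sub_le (toComplex x - (toComplex M - ε * Complex.I * u)) (ε * Complex.I * u)
      rwa [show toComplex x - (toComplex M - ε * Complex.I * u) - ε * Complex.I * u =
        toComplex x - toComplex M by ring] at this
    rw [hεu] at h5
    simp only [Complex.norm_ofNat]
    linarith
  -- the logarithm of `r` along the first edge
  set τ : Plane → ℝ := fun x => ((toComplex x - toComplex M) / u).re / ε with hτ
  set l : Plane → ℂ := fun x => (2 * Real.arctan (τ x) + Real.pi : ℝ) * Complex.I with hl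
  have hτc : Continuous τ := by
    have := toComplex.continuous
    fun_prop
  have hlc : Continuous l := by fun_prop
  have hτval : ∀ (x : Plane) (t : ℝ), toComplex x = toComplex M + t * u → τ x = t / ε := by
    intro x t ht
    simp only [hτ]
    rw [ht, add_sub_cancel_left, mul_div_cancel_right₀ _ hu0, Complex.ofReal_re]
  have hlr : ∀ x ∈ J, Complex.exp (l x) = r x := by
    intro x hx
    obtain ⟨t, ht⟩ := hJpt x hx
    have hεc : (ε : ℂ) ≠ 0 := Complex.ofReal_ne_zero.2 hε0.ne'
    simp only [hl, hr, hτval x t ht]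
    rw [ht, hqc, hqc', Complex.ofReal_add, add_mul, Complex.exp_add, Complex.exp_pi_mul_I,
      exp_two_arctan_mul_I,
      show toComplex M + t * u - (toComplex M + ε * Complex.I * u) =
          (t - ε * Complex.I) * u by ring,
      show toComplex M + t * u - (toComplex M - ε * Complex.I * u) =
          (t + ε * Complex.I) * u by ring, mul_div_mul_right _ _ hu0]
    have h1 : (ε : ℂ) - t * Complex.I = -Complex.I * (t + ε * Complex.I) := by
      linear_combination (ε : ℂ) * Complex.I_sq
    have h2 : (ε : ℂ) + t * Complex.I = Complex.I * (t - ε * Complex.I) := by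
      linear_combination (ε : ℂ) * Complex.I_sq
    have e1 : 1 + ((t / ε : ℝ) : ℂ) * Complex.I = (ε + t * Complex.I) / ε := by
      push_cast; field_simp
    have e2 : 1 - ((t / ε : ℝ) : ℂ) * Complex.I = (ε - t * Complex.I) / ε := by
      push_cast; field_simp
    rw [e1, e2, div_div_div_cancel_right₀ hεc, h1, h2, neg_mul, div_neg,
      mul_div_mul_left _ _ Complex.I_ne_zero]
    ring
  set θ := Real.arctan (1 / 2 / ε) with hθ
  have hθ0 : 0 < θ := Real.arctan_pos.2 (by positivity)
  have hθ1 : θ < Real.pi / 2 := Real.arctan_lt_pi_div_two _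
  have hl1 : l v1 = (2 * θ + Real.pi : ℝ) * Complex.I := by
    simp only [hl]
    rw [hτval v1 (1 / 2) (by rw [hMc, hu]; push_cast; ring)]
  have hl0 : l v0 = (-(2 * θ) + Real.pi : ℝ) * Complex.I := by
    simp only [hl]
    rw [hτval v0 (-(1 / 2)) (by rw [hMc, hu]; push_cast; ring), neg_div, Real.arctan_neg, ← hθ]
    push_cast; ring
  have hlog1 : Complex.log (r v1) = l v1 - 2 * Real.pi * Complex.I := by
    rw [← hlr v1 (right_mem_segment ℝ _ _), ← Complex.exp_periodic.sub_eq (l v1),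
      Complex.log_exp] <;> rw [hl1] <;> simp <;> linarith
  have hlog0 : Complex.log (r v0) = l v0 := by
    rw [← hlr v0 (left_mem_segment ℝ _ _), Complex.log_exp] <;> rw [hl0] <;> simp <;> linarith
  refine ⟨q, q', fun h => (hb q h).1 (sub_self _), fun h => (hb q' h).2 (sub_self _), ?_⟩
  intro f hf hf0
  obtain ⟨k, hk, ek⟩ := P.hasLog_arc hf hf0
  obtain ⟨m, hm, em⟩ := hasLog_segment (hf.mono hJb) fun x hx => hf0 x (hJb hx)
  obtain ⟨a, ha⟩ := exists_int_sub_eq_of_exp_eq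
    ((ek v1 P.vertex_one_mem_arc).trans (em v1 (right_mem_segment ℝ _ _)).symm)
  obtain ⟨b, hb'⟩ := exists_int_sub_eq_of_exp_eq
    ((ek v0 P.vertex_zero_mem_arc).trans (em v0 (left_mem_segment ℝ _ _)).symm)
  refine ⟨a - b, P.hasLog_boundary_of_jump (k := fun x => k x + (a - b : ℤ) * Complex.log (r x))
    (l := fun x => m x + (a - b : ℤ) * l x) ?_ (hm.add (by fun_prop)) ?_ ?_ ?_⟩
  · exact hk.add (continuousOn_const.mul fun x hx => (hrc.mono harc x hx).clog (hslit x hx))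
  · intro x hx
    rw [Complex.exp_add, Complex.exp_int_mul, ek x hx,
      Complex.exp_log (Complex.slitPlane_ne_zero (hslit x hx))]
  · intro x hx
    rw [Complex.exp_add, Complex.exp_int_mul, em x hx, hlr x hx]
  · rw [← hv0, ← hv1, hlog0, hlog1]
    push_cast
    linear_combination ha - hb'

/-- A function without zeros on the region has a logarithm there as soon as it has one on the
boundary after multiplication with a function without zeros in the closed exterior. -/
theorem hasLog_region_of_boundary {f s : Plane → ℂ} (hf : ContinuousOn f P.region)
    (hf0 : ∀ x ∈ P.region, f x ≠ 0) (hs : ContinuousOn s P.closedExterior)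
    (hs0 : ∀ x ∈ P.closedExterior, s x ≠ 0) (h : HasLog (fun x => f x * s x) P.boundary) :
    HasLog f P.region := by
  classical
  obtain ⟨H, hH⟩ := h.exists_continuousMap P.isClosed_boundary
  set G := P.region.piecewise f (fun x => Complex.exp (H x) / s x) with hG
  have hGf : EqOn G f P.region := piecewise_eqOn _ _ _
  have hGs : EqOn G (fun x => Complex.exp (H x) / s x) P.closedExterior := by
    intro x hx
    by_cases hxr : x ∈ P.region
    · have hxb : x ∈ P.boundary := by_contra fun hb => hx ⟨hxr, hb⟩
      rw [hGf hxr]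
      exact (eq_div_iff (hs0 x hx)).2 (hH x hxb).symm
    · exact piecewise_eq_of_notMem _ _ _ hxr
  have hcover : P.region ∪ P.closedExterior = univ := by
    ext x; simp only [closedExterior, mem_union, mem_compl_iff, mem_sdiff, mem_univ]; tauto
  have hGc : Continuous G := by
    rw [← continuousOn_univ, ← hcover]
    refine ContinuousOn.union_of_isClosed (hf.congr hGf) (ContinuousOn.congr ?_ hGs)
      P.isClosed_region P.isOpen_region_diff_boundary.isClosed_compl
    exact (Complex.continuous_exp.comp H.continuous).continuousOn.div hs hs0
  refine (HasLog.of_continuous hGc fun x => ?_).congr hGf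
  rcases (hcover ▸ mem_univ x : x ∈ P.region ∪ P.closedExterior) with hx | hx
  · rw [hGf hx]; exact hf0 x hx
  · rw [hGs hx]; exact div_ne_zero (Complex.exp_ne_zero _) (hs0 x hx)

/-- For a point `q` of an unbounded component, `z - q` has a logarithm on the boundary. -/
theorem hasLog_sub_of_notMem_region {q : Plane} (hq : q ∉ P.region) :
    HasLog (fun x => toComplex x - toComplex q) P.boundary := by
  have hqb : q ∉ P.boundary := fun h => hq (P.boundary_subset_region h)
  have hunb : ¬ Bornology.IsBounded (connectedComponentIn P.boundaryᶜ q) := fun h =>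
    hq (Or.inr ⟨hqb, h⟩)
  set C := connectedComponentIn P.boundaryᶜ q with hC
  obtain ⟨R, hR⟩ := P.isCompact_boundary.isBounded.exists_norm_le
  have hqC : q ∈ C := mem_connectedComponentIn hqb
  obtain ⟨p, hpC, hpR⟩ : ∃ p ∈ C, R < ‖p‖ := by
    by_contra! h
    exact hunb (isBounded_iff_forall_norm_le.2 ⟨R, h⟩)
  -- moving the point a little multiplies the function by one with values in the slit plane
  have hmove : ∀ a ∉ P.boundary, ∃ ε > 0, ∀ b, dist b a < ε → b ∉ P.boundary ∧
      (HasLog (fun x => toComplex x - toComplex a) P.boundary ↔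
        HasLog (fun x => toComplex x - toComplex b) P.boundary) := by
    intro a ha
    obtain ⟨ε, hε, hball⟩ := Metric.isOpen_iff.1 P.isClosed_boundary.isOpen_compl a ha
    refine ⟨ε, hε, fun b hb => ⟨hball hb, ?_⟩⟩
    have hne : ∀ c ∉ P.boundary, ∀ x ∈ P.boundary, toComplex x - toComplex c ≠ 0 :=
      fun c hc x hx h => hc (by rwa [← toComplex.injective (sub_eq_zero.1 h)])
    have hq : HasLog (fun x => (toComplex x - toComplex b) / (toComplex x - toComplex a))
        P.boundary := by
      refine HasLog.of_mem_slitPlane ?_ fun x hx => ?_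
      · exact ContinuousOn.div (toComplex.continuous.sub continuous_const).continuousOn
          (toComplex.continuous.sub continuous_const).continuousOn (hne a ha)
      · have h2 := hne a ha x hx
        rw [show (toComplex x - toComplex b) / (toComplex x - toComplex a) =
          1 + (toComplex a - toComplex b) / (toComplex x - toComplex a) by field_simp; ring]
        refine Complex.mem_slitPlane_of_norm_lt_one ?_
        rw [norm_div, div_lt_one (norm_pos_iff.2 h2), ← dist_eq_norm, ← dist_eq_norm,
          toComplex.dist_map, toComplex.dist_map, dist_comm]
        refine hb.trans_le ?_
        by_contra! hlt
        exact hball (show x ∈ Metric.ball a ε from hlt) hx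
    constructor
    · intro h
      exact (h.mul hq).congr fun x hx => mul_div_cancel₀ _ (hne a ha x hx)
    · intro h
      exact (h.mul hq.inv).congr fun x hx => by
        have h1 := hne a ha x hx
        have h2 := hne b (hball hb) x hx
        field_simp
  have hfar : HasLog (fun x => toComplex x - toComplex p) P.boundary := by
    have hp0 : toComplex p ≠ 0 := fun h => by
      rw [← norm_eq_zero, toComplex.norm_map] at h
      have := hR _ P.vertex_zero_mem_boundary
      linarith [norm_nonneg (P.vertex 0)]
    refine ((HasLog.const (neg_ne_zero.2 hp0)).mul (HasLog.of_mem_slitPlane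
      (f := fun x => 1 + -(toComplex x / toComplex p)) ?_ fun x hx => ?_)).congr fun x hx => ?_
    · have := toComplex.continuous
      fun_prop
    · refine Complex.mem_slitPlane_of_norm_lt_one ?_
      rw [norm_neg, norm_div, toComplex.norm_map, toComplex.norm_map,
        div_lt_one ((norm_nonneg x).trans_lt ((hR x hx).trans_lt hpR))]
      exact (hR x hx).trans_lt hpR
    · field_simp; ring
  by_contra hnot
  have hsub := isPreconnected_connectedComponentIn (F := P.boundaryᶜ) (x := q)
  obtain ⟨z, -, hz1, hz2⟩ := hsub
    {a | a ∉ P.boundary ∧ HasLog (fun x => toComplex x - toComplex a) P.boundary}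
    {a | a ∉ P.boundary ∧ ¬ HasLog (fun x => toComplex x - toComplex a) P.boundary}
    (Metric.isOpen_iff.2 fun a ha => by
      obtain ⟨ε, hε, h⟩ := hmove a ha.1
      exact ⟨ε, hε, fun b hb => ⟨(h b hb).1, (h b hb).2.1 ha.2⟩⟩)
    (Metric.isOpen_iff.2 fun a ha => by
      obtain ⟨ε, hε, h⟩ := hmove a ha.1
      exact ⟨ε, hε, fun b hb => ⟨(h b hb).1, fun hl => ha.2 ((h b hb).2.2 hl)⟩⟩)
    (fun a ha => by
      have : a ∉ P.boundary := connectedComponentIn_subset _ _ ha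
      by_cases h : HasLog (fun x => toComplex x - toComplex a) P.boundary
      · exact Or.inl ⟨this, h⟩
      · exact Or.inr ⟨this, h⟩)
    ⟨p, hpC, connectedComponentIn_subset _ _ hpC, hfar⟩ ⟨q, hqC, hqb, hnot⟩
  exact hz2.2 hz1.2

/-- On the boundary, `z - q` agrees up to an exponential with a function without zeros in the closed
exterior. -/
theorem exists_nonvanishing_exterior {q : Plane} (hq : q ∉ P.boundary) :
    ∃ a : Plane → ℂ, ContinuousOn a P.closedExterior ∧ (∀ x ∈ P.closedExterior, a x ≠ 0) ∧
      HasLog (fun x => (toComplex x - toComplex q) / a x) P.boundary := by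
  by_cases hr : q ∈ P.region
  · have hne : ∀ x ∈ P.closedExterior, toComplex x - toComplex q ≠ 0 := fun x hx h =>
      hx (by rw [toComplex.injective (sub_eq_zero.1 h)]; exact ⟨hr, hq⟩)
    refine ⟨fun x => toComplex x - toComplex q,
      (toComplex.continuous.sub continuous_const).continuousOn, hne, ?_⟩
    exact (HasLog.const one_ne_zero).congr fun x hx =>
      (div_self (hne x (P.boundary_subset_closedExterior hx))).symm
  · exact ⟨fun _ => 1, continuousOn_const, fun _ _ => one_ne_zero,
      (P.hasLog_sub_of_notMem_region hr).congr fun x _ => (div_one _).symm⟩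

/-- Every function without zeros on a simple polygon has a continuous logarithm. -/
theorem hasLog_region {f : Plane → ℂ} (hf : ContinuousOn f P.region)
    (hf0 : ∀ x ∈ P.region, f x ≠ 0) : HasLog f P.region := by
  obtain ⟨q, q', hq, hq', h⟩ := P.exists_generator
  obtain ⟨n, hn⟩ := h f (hf.mono P.boundary_subset_region)
    fun x hx => hf0 x (P.boundary_subset_region hx)
  obtain ⟨a, hac, ha0, ha⟩ := P.exists_nonvanishing_exterior hq
  obtain ⟨b, hbc, hb0, hb⟩ := P.exists_nonvanishing_exterior hq'
  have hs0 : ∀ x ∈ P.closedExterior, a x / b x ≠ 0 := fun x hx => div_ne_zero (ha0 x hx) (hb0 x hx)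
  refine P.hasLog_region_of_boundary hf hf0 (s := fun x => (a x / b x) ^ n)
    ((hac.div hbc hb0).zpow₀ n fun x hx => Or.inl (hs0 x hx)) (fun x hx => zpow_ne_zero n (hs0 x hx))
    ((hn.mul ((hb.mul ha.inv).zpow n)).congr fun x hx => ?_)
  have hxe := P.boundary_subset_closedExterior hx
  have hsub : ∀ p ∉ P.boundary, toComplex x - toComplex p ≠ 0 := fun p hp h =>
    hp (by rwa [← toComplex.injective (sub_eq_zero.1 h)])
  have h1 := ha0 x hxe
  have h2 := hb0 x hxe
  have h3 := hsub q hq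
  have h4 := hsub q' hq'
  rw [mul_assoc, ← mul_zpow]
  congr 2
  field_simp

end SimplePolygon

/-- Near a point `p`, a segment is a union of radii from `p`. -/
theorem eventually_lineMap_mem_segment (a b p : Plane) : ∀ᶠ x in nhds p, ∀ t ∈ Ioc (0 : ℝ) 1,
    AffineMap.lineMap p x t ∈ segment ℝ a b → segment ℝ p x ⊆ segment ℝ a b := by
  by_cases hp : p ∈ segment ℝ a b
  · suffices h : ∀ᶠ x in nhds p, ∀ t ∈ Ioc (0 : ℝ) 1,
        AffineMap.lineMap p x t ∈ segment ℝ a b → x ∈ segment ℝ a b from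
      h.mono fun x hx t ht hm => (convex_segment a b).segment_subset hp (hx t ht hm)
    rw [segment_eq_image_lineMap] at hp ⊢
    obtain ⟨v, hv, rfl⟩ := hp
    set m : ℝ := min (if v = 0 then 1 else v) (if v = 1 then 1 else 1 - v) with hm
    have hm0 : 0 < m := by
      refine lt_min ?_ ?_
      · split_ifs with h
        · exact one_pos
        · exact lt_of_le_of_ne hv.1 (Ne.symm h)
      · split_ifs with h
        · exact one_pos
        · exact sub_pos.2 (lt_of_le_of_ne hv.2 h)
    rcases eq_or_ne a b with rfl | hab
    · refine Filter.Eventually.of_forall fun x t ht ⟨c, hc, h⟩ => ⟨c, hc, ?_⟩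
      simp only [AffineMap.lineMap_same, AffineMap.const_apply] at h ⊢
      rw [AffineMap.lineMap_apply_module', eq_comm, add_eq_right, smul_eq_zero] at h
      rcases h with h | h
      · exact absurd h ht.1.ne'
      · exact (sub_eq_zero.1 h).symm
    · have hba : 0 < ‖b - a‖ := norm_pos_iff.2 (sub_ne_zero.2 hab.symm)
      filter_upwards [Metric.ball_mem_nhds (AffineMap.lineMap a b v) (mul_pos hm0 hba)]
        with x hx t ht ⟨c, hc, h⟩
      have hxe : x = AffineMap.lineMap a b (v + (c - v) / t) := by
        have h' : x - AffineMap.lineMap a b v = ((c - v) / t) • (b - a) := by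
          rw [AffineMap.lineMap_apply_module' _ x] at h
          have : t • (x - AffineMap.lineMap a b v) = (c - v) • (b - a) := by
            rw [eq_sub_of_add_eq h.symm, AffineMap.lineMap_apply_module',
              AffineMap.lineMap_apply_module']
            module
          rw [div_eq_inv_mul, mul_smul, ← this, smul_smul, inv_mul_cancel₀ ht.1.ne', one_smul]
        rw [sub_eq_iff_eq_add.1 h', AffineMap.lineMap_apply_module',
          AffineMap.lineMap_apply_module']
        module
      refine ⟨_, ?_, hxe.symm⟩
      have habs : |(c - v) / t| < m := by
        rw [Metric.mem_ball, hxe, dist_eq_norm, AffineMap.lineMap_apply_module',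
          AffineMap.lineMap_apply_module', add_sub_add_right_eq_sub, ← sub_smul, norm_smul,
          add_sub_cancel_left] at hx
        exact lt_of_mul_lt_mul_right hx hba.le
      obtain ⟨h1, h2⟩ := abs_lt.1 habs
      obtain ⟨h3, h4⟩ := lt_min_iff.1 (habs.trans_eq hm)
      constructor
      · by_cases hv0 : v = 0
        · have := div_nonneg hc.1 ht.1.le
          simpa [hv0] using this
        · rw [if_neg hv0] at h3
          linarith [(abs_lt.1 h3).1]
      · by_cases hv1 : v = 1
        · have := div_nonpos_of_nonpos_of_nonneg (sub_nonpos.2 hc.2) ht.1.le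
          rw [hv1]; linarith
        · rw [if_neg hv1] at h4
          linarith [(abs_lt.1 h4).2]
  · obtain ⟨ε, hε, h⟩ := Metric.isOpen_iff.1
      (SimplePolygon.isClosed_segment a b).isOpen_compl p hp
    filter_upwards [Metric.ball_mem_nhds p hε] with x hx t ht hm
    refine absurd hm (h ((convex_ball p ε).segment_subset (Metric.mem_ball_self hε) hx ?_))
    rw [segment_eq_image_lineMap]
    exact ⟨t, ⟨ht.1.le, ht.2⟩, rfl⟩

namespace SimplePolygon

variable (P : SimplePolygon)

/-- A simple polygon is locally star-shaped. -/
theorem eventually_segment_subset_region {p : Plane} (hp : p ∈ P.region) :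
    ∀ᶠ x in nhds p, x ∈ P.region → segment ℝ p x ⊆ P.region := by
  have hev : ∀ᶠ x in nhds p, ∀ i ∈ Finset.range P.n, ∀ t ∈ Ioc (0 : ℝ) 1,
      AffineMap.lineMap p x t ∈ segment ℝ (P.vertex i) (P.vertex (i + 1)) →
        segment ℝ p x ⊆ segment ℝ (P.vertex i) (P.vertex (i + 1)) :=
    (Filter.eventually_all_finset _).2 fun i _ => eventually_lineMap_mem_segment _ _ p
  filter_upwards [hev] with x hx hxr
  by_cases h : ∃ t ∈ Ioc (0 : ℝ) 1, AffineMap.lineMap p x t ∈ P.boundary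
  · obtain ⟨t, ht, hm⟩ := h
    obtain ⟨i, hi, hm⟩ := mem_iUnion₂.1 hm
    exact (hx i hi t ht hm).trans ((subset_biUnion_of_mem
      (u := fun i => segment ℝ (P.vertex i) (P.vertex (i + 1)))
      (Finset.mem_coe.2 hi)).trans P.boundary_subset_region)
  · push Not at h
    have hpre : IsPreconnected ((AffineMap.lineMap p x : ℝ → Plane) '' Ioc 0 1) :=
      isPreconnected_Ioc.image _ AffineMap.lineMap_continuous.continuousOn
    have hsub : (AffineMap.lineMap p x : ℝ → Plane) '' Ioc 0 1 ⊆ P.boundaryᶜ := by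
      rintro _ ⟨t, ht, rfl⟩
      exact h t ht
    have hx1 : x ∈ (AffineMap.lineMap p x : ℝ → Plane) '' Ioc 0 1 :=
      ⟨1, ⟨one_pos, le_rfl⟩, AffineMap.lineMap_apply_one _ _⟩
    have hbdd : Bornology.IsBounded (connectedComponentIn P.boundaryᶜ x) :=
      (hxr.resolve_left (hsub hx1)).2
    rw [segment_eq_image_lineMap]
    rintro _ ⟨t, ht, rfl⟩
    rcases ht.1.eq_or_lt with rfl | h0
    · rwa [AffineMap.lineMap_apply_zero]
    · refine Or.inr ⟨h t ⟨h0, ht.2⟩, ?_⟩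
      rwa [← connectedComponentIn_eq
        (hpre.subset_connectedComponentIn hx1 hsub ⟨t, ⟨h0, ht.2⟩, rfl⟩)]

/-- Janiszewski's theorem in a simple polygon: if neither of two disjoint closed sets separates
`x` from `y`, then their union does not either. -/
theorem joinedIn_diff_union {A B : Set Plane} (hA : IsClosed A) (hB : IsClosed B)
    (hAB : Disjoint A B) {x y : Plane} (h1 : JoinedIn (P.region \ A) x y)
    (h2 : JoinedIn (P.region \ B) x y) : JoinedIn (P.region \ (A ∪ B)) x y := by
  classical
  by_contra hn
  set C : Set Plane := {z | JoinedIn (P.region \ (A ∪ B)) x z} with hC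
  have hxU : x ∈ P.region \ (A ∪ B) :=
    ⟨h1.source_mem.1, fun h => h.elim h1.source_mem.2 h2.source_mem.2⟩
  have hxC : x ∈ C := JoinedIn.refl hxU
  have hyC : y ∉ C := hn
  obtain ⟨φ, hφA, hφB, -⟩ := exists_continuous_zero_one_of_isClosed hA hB hAB
  have hloc : ∀ z ∈ P.region, z ∉ A ∪ B →
      ∀ᶠ z' in nhdsWithin z P.region, (z' ∈ C ↔ z ∈ C) := by
    intro z hz hzAB
    obtain ⟨ε, hε, hball⟩ := Metric.isOpen_iff.1 (hA.union hB).isOpen_compl z hzAB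
    filter_upwards [self_mem_nhdsWithin,
      mem_nhdsWithin_of_mem_nhds (P.eventually_segment_subset_region hz),
      mem_nhdsWithin_of_mem_nhds (Metric.ball_mem_nhds z hε)] with z' hz' hseg hzε
    have hj : JoinedIn (P.region \ (A ∪ B)) z z' := JoinedIn.of_segment_subset fun w hw =>
      ⟨hseg hz' hw, hball ((convex_ball z ε).segment_subset (Metric.mem_ball_self hε) hzε hw)⟩
    exact ⟨fun h => h.trans hj.symm, fun h => h.trans hj⟩
  have hpw : ∀ g₁ g₂ : Plane → ℂ, Continuous g₁ → Continuous g₂ → ∀ S ⊆ P.region,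
      (∀ z ∈ S, z ∈ A ∪ B → g₁ z = g₂ z) → ContinuousOn (C.piecewise g₁ g₂) S := by
    intro g₁ g₂ hg₁ hg₂ S hS hg z hz
    by_cases hzAB : z ∈ A ∪ B
    · have e := hg z hz hzAB
      have e1 : C.piecewise g₁ g₂ z = g₁ z := by
        by_cases hzC : z ∈ C
        · rw [piecewise_eq_of_mem _ _ _ hzC]
        · rw [piecewise_eq_of_notMem _ _ _ hzC, e]
      unfold ContinuousWithinAt
      rw [e1]
      exact Filter.Tendsto.if' hg₁.continuousWithinAt (e ▸ hg₂.continuousWithinAt)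
    · have hev := nhdsWithin_mono z hS (hloc z (hS hz) hzAB)
      by_cases hzC : z ∈ C
      · refine hg₁.continuousWithinAt.congr_of_eventuallyEq ?_ (piecewise_eq_of_mem _ _ _ hzC)
        filter_upwards [hev] with z' hz'
        exact piecewise_eq_of_mem _ _ _ (hz'.2 hzC)
      · refine hg₂.continuousWithinAt.congr_of_eventuallyEq ?_ (piecewise_eq_of_notMem _ _ _ hzC)
        filter_upwards [hev] with z' hz'
        exact piecewise_eq_of_notMem _ _ _ fun h => hzC (hz'.1 h)
  set ψ : Plane → ℂ := fun z => φ z * (2 * Real.pi * Complex.I) with hψ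
  have hψc : Continuous ψ := by fun_prop
  have hψA : ∀ z ∈ A, ψ z = 0 := fun z hz => by simp [hψ, hφA hz]
  have hψB : ∀ z ∈ B, ψ z = 2 * Real.pi * Complex.I := fun z hz => by simp [hψ, hφB hz]
  set f : Plane → ℂ := C.piecewise (fun z => Complex.exp (ψ z)) (fun _ => 1) with hf
  have hfc : ContinuousOn f P.region := by
    refine hpw _ _ (Complex.continuous_exp.comp hψc) continuous_const _ Subset.rfl ?_
    rintro z - (hz | hz)
    · simp only [Function.comp_apply, hψA z hz, Complex.exp_zero]
    · simp only [Function.comp_apply, hψB z hz, Complex.exp_two_pi_mul_I]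
  obtain ⟨g, hg, eg⟩ := P.hasLog_region hfc fun z _ => by
    by_cases hzC : z ∈ C
    · rw [hf, piecewise_eq_of_mem _ _ _ hzC]; exact Complex.exp_ne_zero _
    · rw [hf, piecewise_eq_of_notMem _ _ _ hzC]; exact one_ne_zero
  have key : ∀ (D : Set Plane) (c : ℂ), Complex.exp c = 1 →
      (∀ z ∈ P.region \ D, z ∈ A ∪ B → ψ z = c) → JoinedIn (P.region \ D) x y →
      g x - ψ x = g y - c := by
    rintro D c hc hD ⟨γ, hγ⟩
    have hsub : range γ ⊆ P.region \ D := range_subset_iff.2 hγ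
    have := log_sub_log_eq (isPreconnected_range γ.continuous)
      (hg.mono (hsub.trans sdiff_subset))
      ((hpw ψ (fun _ => c) hψc continuous_const _ sdiff_subset hD).mono hsub)
      (fun z hz => by
        rw [eg z (hsub hz).1, hf]
        by_cases hzC : z ∈ C
        · rw [piecewise_eq_of_mem _ _ _ hzC, piecewise_eq_of_mem _ _ _ hzC]
        · rw [piecewise_eq_of_notMem _ _ _ hzC, piecewise_eq_of_notMem _ _ _ hzC, hc])
      ⟨0, γ.source⟩ ⟨1, γ.target⟩
    rwa [piecewise_eq_of_mem _ _ _ hxC, piecewise_eq_of_notMem _ _ _ hyC] at this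
  have hkA := key A _ Complex.exp_two_pi_mul_I
    (fun z hz hzAB => hψB z (hzAB.resolve_left hz.2)) h1
  have hkB := key B 0 Complex.exp_zero (fun z hz hzAB => hψA z (hzAB.resolve_right hz.2)) h2
  exact Complex.two_pi_I_ne_zero (by linear_combination hkA - hkB)

variable {P} {W : Set Plane}

/-- A neighbor witness path avoids the visibility regions of all other witnesses. -/
theorem GConAdj.joinedIn (hW : P.IsWitnessSet W) {a b u : Plane} (h : P.GConAdj W a b)
    (hu : u ∈ W) (ha : u ≠ a) (hb : u ≠ b) : JoinedIn (P.region \ P.Vis u) a b := by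
  obtain ⟨haW, hbW, -, γ, f, rfl, hf⟩ := h
  refine ⟨f, fun t => ?_⟩
  have hdisj : ∀ c ∈ W, u ≠ c → ∀ z ∈ P.Vis c, z ∉ P.Vis u := fun c hc hne z hz hzu =>
    (hW.2.2 u hu c hc hne ▸ ⟨hzu, hz⟩ : z ∈ (∅ : Set Plane))
  rcases hf ⟨t, rfl⟩ with (h | h) | h
  · exact ⟨h.1, hdisj a haW ha _ h⟩
  · exact ⟨h.1, fun hz => h.2 (mem_biUnion hu hz)⟩
  · exact ⟨h.1, hdisj b hbW hb _ h⟩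

/-- If no single visibility region separates `x` from `y`, then finitely many do not either. -/
theorem joinedIn_diff_biUnion_Vis (hW : P.IsWitnessSet W) {x y : Plane}
    (hxy : JoinedIn P.region x y) {F : Set Plane} (hF : F.Finite) (hFW : F ⊆ W)
    (h : ∀ u ∈ F, JoinedIn (P.region \ P.Vis u) x y) :
    JoinedIn (P.region \ ⋃ u ∈ F, P.Vis u) x y := by
  induction F, hF using Set.Finite.induction_on with
  | empty => simpa using hxy
  | @insert a s has hs ih =>
    rw [biUnion_insert]
    refine P.joinedIn_diff_union (P.isClosed_Vis a)
      (hs.isClosed_biUnion fun u _ => P.isClosed_Vis u) ?_ (h a (mem_insert _ _))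
      (ih ((subset_insert _ _).trans hFW) fun u hu => h u (mem_insert_of_mem _ hu))
    refine disjoint_iUnion₂_right.2 fun u hu => disjoint_iff_inter_eq_empty.2 ?_
    exact hW.2.2 a (hFW (mem_insert _ _)) u (hFW (mem_insert_of_mem _ hu))
      fun e => has (e ▸ hu)

/-- Two witnesses not separated by the visibility region of a third one are adjacent. -/
theorem gConAdj_of_joinedIn (hW : P.IsWitnessSet W) {x y : Plane} (hx : x ∈ W) (hy : y ∈ W)
    (hne : x ≠ y) (hxy : JoinedIn P.region x y)
    (h : ∀ u ∈ W, u ≠ x → u ≠ y → JoinedIn (P.region \ P.Vis u) x y) : P.GConAdj W x y := by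
  obtain ⟨γ, hγ⟩ := joinedIn_diff_biUnion_Vis hW hxy (hW.1.sdiff (t := {x, y})) sdiff_subset
    fun u hu => h u hu.1 (fun e => hu.2 (Or.inl e)) fun e => hu.2 (Or.inr e)
  refine ⟨hx, hy, hne, _, γ, rfl, range_subset_iff.2 fun t => ?_⟩
  by_cases h1 : γ t ∈ P.Vis x
  · exact Or.inl (Or.inl h1)
  by_cases h2 : γ t ∈ P.Vis y
  · exact Or.inr h2
  refine Or.inl (Or.inr ⟨(hγ t).1, fun hu => ?_⟩)
  obtain ⟨u, hu, hm⟩ := mem_iUnion₂.1 hu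
  refine (hγ t).2 (mem_biUnion ⟨hu, ?_⟩ hm)
  rintro (rfl | rfl)
  · exact h1 hm
  · exact h2 hm

end SimplePolygon

/-- The neighbor witness graph is chordal: every cycle of length at least
four has a chord. -/
theorem gcon_chordal (P : SimplePolygon) (W : Set Plane)
    (hW : P.IsWitnessSet W) (hreg : ∀ u ∈ W, P.VisRegular u)
    (m : ℕ) (hm : 4 ≤ m) (w : ℕ → Plane)
    (hinj : ∀ i < m, ∀ j < m, w i = w j → i = j)
    (hadj : ∀ i < m, P.GConAdj W (w i) (w ((i + 1) % m))) :
    ∃ i < m, ∃ j < m, j ≠ i ∧ j ≠ (i + 1) % m ∧ i ≠ (j + 1) % m ∧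
      P.GConAdj W (w i) (w j) := by
  have hlt : ∀ i < m, w i ∈ W := fun i hi => (hadj i hi).1
  have hne : ∀ i < m, ∀ j < m, i ≠ j → w i ≠ w j := fun i hi j hj hij h => hij (hinj i hi j hj h)
  have hstep : ∀ i, i + 1 < m → P.GConAdj W (w i) (w (i + 1)) := fun i hi => by
    have := hadj i (by omega)
    rwa [Nat.mod_eq_of_lt hi] at this
  have hlast : P.GConAdj W (w (m - 1)) (w 0) := by
    have := hadj (m - 1) (by omega)
    rwa [Nat.sub_add_cancel (by omega), Nat.mod_self] at this
  have hshort : ∀ u ∈ W, u ≠ w 0 → u ≠ w 1 → u ≠ w 2 →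
      JoinedIn (P.region \ P.Vis u) (w 0) (w 2) := fun u hu h0 h1 h2 =>
    ((hstep 0 (by omega)).joinedIn hW hu h0 h1).trans ((hstep 1 (by omega)).joinedIn hW hu h1 h2)
  have hlong : JoinedIn (P.region \ P.Vis (w 1)) (w 0) (w 2) := by
    have hm1 := hlt 1 (by omega)
    have hchain : ∀ k, 2 ≤ k → k < m → JoinedIn (P.region \ P.Vis (w 1)) (w 2) (w k) := by
      intro k hk
      induction k, hk using Nat.le_induction with
      | base =>
        intro _
        exact JoinedIn.refl ((hstep 2 (by omega)).joinedIn hW hm1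
          (hne 1 (by omega) 2 (by omega) (by omega))
          (hne 1 (by omega) 3 (by omega) (by omega))).source_mem
      | succ k hk ih =>
        intro hkm
        exact (ih (by omega)).trans ((hstep k hkm).joinedIn hW hm1
          (hne 1 (by omega) k (by omega) (by omega))
          (hne 1 (by omega) (k + 1) hkm (by omega)))
    exact ((hchain (m - 1) (by omega) (by omega)).trans (hlast.joinedIn hW hm1
      (hne 1 (by omega) (m - 1) (by omega) (by omega))
      (hne 1 (by omega) 0 (by omega) (by omega)))).symm
  refine ⟨0, by omega, 2, by omega, by omega, ?_, ?_, SimplePolygon.gConAdj_of_joinedIn hW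
    (hlt 0 (by omega)) (hlt 2 (by omega)) (hne 0 (by omega) 2 (by omega) (by omega))
    (hlong.mono sdiff_subset) fun u hu h0 h2 => ?_⟩
  · rw [Nat.mod_eq_of_lt (by omega)]; omega
  · rw [Nat.mod_eq_of_lt (by omega)]; omega
  · by_cases h1 : u = w 1
    · exact h1 ▸ hlong
    · exact hshort u hu h0 h1 h2
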